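/- For every f ∈ C_c^∞(ℝⁿ×ℝⁿ) and every smooth compactly supported function K on ℝ^{n−1}×ℝ^{n−1}×ℝ₊×ℝ₊, liminf_{ℏ→0⁺} ‖ρ_ℏ(f) + κ_ℏ(K)‖ ≥ ‖π₀(f)‖, where the first norm is the operator norm on L²(ℝⁿ₊). -/

import Mathlib

open MeasureTheory Filter Topology Set
open scoped ContDiff

noncomputable section

/-- `ℝ^{n−1}`, the boundary directions. -/
abbrev Eb (n : ℕ) : Type := Fin (n - 1) → ℝ

/-- `ℝⁿ` written as `ℝ^{n−1} × ℝ`; a point is `x = (x', xₙ)`. -/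
abbrev Ef (n : ℕ) : Type := Eb n × ℝ

/-- Lebesgue measure restricted to the closed half-space `ℝⁿ₊ = {x : xₙ ≥ 0}`. -/
def muPlus (n : ℕ) : Measure (Ef n) := volume.restrict {p : Ef n | 0 ≤ p.2}

/-- `L²(ℝⁿ₊)`. -/
abbrev HS (n : ℕ) := Lp ℂ 2 (muPlus n)

/-- `T` is the ℏ-scaled truncated operator `ρ_ℏ(f)` on `L²(ℝⁿ₊)`:
`(ρ_ℏ(f)ξ)(x) = ∫_{v : xₙ ≥ ℏvₙ} f(x,v) ξ(x−ℏv) dv`. -/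
def rhoSpec (n : ℕ) (ℏ : ℝ) (f : Ef n × Ef n → ℂ) (T : HS n →L[ℂ] HS n) : Prop :=
  ∀ ξ : HS n, ⇑(T ξ) =ᵐ[muPlus n]
    fun x => ∫ v in {v : Ef n | ℏ * v.2 ≤ x.2},
      f (x, v) * (ξ (x.1 - ℏ • v.1, x.2 - ℏ * v.2))

/-- `S` is the ℏ-scaled Green-type operator `κ_ℏ(K)` on `L²(ℝⁿ₊)`:
`(κ_ℏ(K)ξ)(x',xₙ) = ∫_{ℝ^{n−1}} ∫₀^∞ K(x',y',xₙ/ℏ,yₙ) ξ(x'−ℏy', ℏyₙ) dyₙ dy'`. -/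
def kappaSpec (n : ℕ) (ℏ : ℝ) (K : Eb n × Eb n × ℝ × ℝ → ℂ) (S : HS n →L[ℂ] HS n) : Prop :=
  ∀ ξ : HS n, ⇑(S ξ) =ᵐ[muPlus n]
    fun x => ∫ y' : Eb n, ∫ yn in Ioi (0:ℝ),
      K (x.1, y', x.2 / ℏ, yn) * (ξ (x.1 - ℏ • y', ℏ * yn))

/-- The measure on `ℝⁿ₊ × ℝⁿ` (base point in the half-space, tangent vector free). -/
def muT (n : ℕ) : Measure (Ef n × Ef n) := (muPlus n).prod volume

/-- `L²(ℝⁿ₊ × ℝⁿ)`. -/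
abbrev HT (n : ℕ) := Lp ℂ 2 (muT n)

/-- `P` is the fiberwise convolution operator `π₀(f)` on `L²(ℝⁿ₊×ℝⁿ)`:
`(π₀(f)ξ)(x,v) = ∫ f(x,w) ξ(x,v−w) dw`. -/
def pi0Spec (n : ℕ) (f : Ef n × Ef n → ℂ) (P : HT n →L[ℂ] HT n) : Prop :=
  ∀ ξ : HT n, ⇑(P ξ) =ᵐ[muT n] fun p => ∫ w : Ef n, f (p.1, w) * (ξ (p.1, p.2 - w))

/-- Lebesgue measure on `ℝ^{n−1} × ℝ^{n−1} × ℝ` restricted to `ℝ^{n−1} × ℝ^{n−1} × ℝ₊`. -/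
def muB (n : ℕ) : Measure (Eb n × Eb n × ℝ) :=
  volume.restrict {q : Eb n × Eb n × ℝ | 0 ≤ q.2.2}

/-- `L²(ℝ^{n−1} × ℝ^{n−1} × ℝ₊)`. -/
abbrev HB (n : ℕ) := Lp ℂ 2 (muB n)

/-- `B` is the boundary operator `π₀^∂(f⊕K)` on `L²(ℝ^{n−1}×ℝ^{n−1}×ℝ₊)`:
`(π₀^∂(f⊕K)ξ)(x',v',vₙ) = ∫_{ℝ^{n−1}} ∫₀^∞ [f(x',0,v'−w',vₙ−wₙ) + K(x',v'−w',vₙ,wₙ)]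
ξ(x',w',wₙ) dwₙ dw'`. -/
def piBSpec (n : ℕ) (f : Ef n × Ef n → ℂ) (K : Eb n × Eb n × ℝ × ℝ → ℂ)
    (B : HB n →L[ℂ] HB n) : Prop :=
  ∀ ξ : HB n, ⇑(B ξ) =ᵐ[muB n]
    fun q => ∫ w' : Eb n, ∫ wn in Ioi (0:ℝ),
      (f ((q.1, (0:ℝ)), (q.2.1 - w', q.2.2 - wn)) + K (q.1, q.2.1 - w', q.2.2, wn)) *
        (ξ (q.1, w', wn))

/-- Fiberwise convolution `(f*g)(x,w) = ∫ f(x,v) g(x,w−v) dv`. -/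
def fconv (n : ℕ) (f g : Ef n × Ef n → ℂ) : Ef n × Ef n → ℂ :=
  fun p => ∫ v : Ef n, f (p.1, v) * g (p.1, p.2 - v)

/-- The Green symbol `l(f,g)(x',y',xₙ,yₙ) =
−∫_{ℝ^{n−1}} ∫_{xₙ}^∞ f(x',0,y'−v',vₙ) g(x',0,v',xₙ−vₙ−yₙ) dvₙ dv'`. -/
def lGreen (n : ℕ) (f g : Ef n × Ef n → ℂ) : Eb n × Eb n × ℝ × ℝ → ℂ :=
  fun q => -(∫ v' : Eb n, ∫ vn in Ici q.2.2.1,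
    f ((q.1, (0:ℝ)), (q.2.1 - v', vn)) * g ((q.1, (0:ℝ)), (v', q.2.2.1 - vn - q.2.2.2)))


open scoped ENNReal

lemma Lp_enorm_sq {α : Type*} [MeasurableSpace α] {μ : Measure α} (ξ : Lp ℂ 2 μ) :
    ‖ξ‖ₑ ^ 2 = ∫⁻ x, ‖ξ x‖ₑ ^ 2 ∂μ := by
  rw [Lp.enorm_def]
  have := eLpNorm_nnreal_pow_eq_lintegral (μ := μ) (f := (ξ : α → ℂ)) (p := 2) (by norm_num)
  simpa using this

lemma opNorm_le_of_sq {α : Type*} [MeasurableSpace α] {μ : Measure α}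
    (T : Lp ℂ 2 μ →L[ℂ] Lp ℂ 2 μ) (M : ℝ) (hM : 0 ≤ M)
    (h : ∀ ξ : Lp ℂ 2 μ, ∫⁻ x, ‖T ξ x‖ₑ ^ 2 ∂μ ≤ ENNReal.ofReal M ^ 2 * ∫⁻ x, ‖ξ x‖ₑ ^ 2 ∂μ) :
    ‖T‖ ≤ M := by
  refine T.opNorm_le_bound hM fun ξ => ?_
  have h1 := h ξ
  rw [← Lp_enorm_sq, ← Lp_enorm_sq, ← mul_pow] at h1
  have h2 := (ENNReal.pow_le_pow_left_iff (n := 2) (by norm_num)).1 h1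
  rw [← ofReal_norm, ← ofReal_norm, ← ENNReal.ofReal_mul hM] at h2
  exact (ENNReal.ofReal_le_ofReal_iff (by positivity)).1 h2

lemma sq_le_of_opNorm {α : Type*} [MeasurableSpace α] {μ : Measure α}
    (T : Lp ℂ 2 μ →L[ℂ] Lp ℂ 2 μ) (M : ℝ) (h : ‖T‖ ≤ M) (ξ : Lp ℂ 2 μ) :
    ∫⁻ x, ‖T ξ x‖ₑ ^ 2 ∂μ ≤ ENNReal.ofReal M ^ 2 * ∫⁻ x, ‖ξ x‖ₑ ^ 2 ∂μ := by
  rw [← Lp_enorm_sq, ← Lp_enorm_sq, ← mul_pow]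
  gcongr
  have hM : 0 ≤ M := (norm_nonneg _).trans h
  rw [← ofReal_norm, ← ofReal_norm, ← ENNReal.ofReal_mul hM]
  exact ENNReal.ofReal_le_ofReal (T.le_of_opNorm_le h ξ)

lemma sq_lintegral_le' {α : Type*} [MeasurableSpace α] (ν : Measure α) {g : α → ℝ≥0∞}
    (hg : AEMeasurable g ν) : (∫⁻ x, g x ∂ν) ^ 2 ≤ ν univ * ∫⁻ x, g x ^ 2 ∂ν := by
  have h := ENNReal.lintegral_mul_le_Lp_mul_Lq ν (p := 2) (q := 2)
    ⟨by norm_num, by norm_num, by norm_num⟩ (f := fun _ => 1) (g := g) aemeasurable_const hg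
  simp only [Pi.mul_apply, one_mul, ENNReal.rpow_two, one_pow, lintegral_one] at h
  calc _ ≤ _ := pow_le_pow_left' h 2
    _ = _ := by
      have key : ∀ a : ℝ≥0∞, (a ^ (1 / 2 : ℝ)) ^ 2 = a := fun a => by
        rw [← ENNReal.rpow_natCast, ← ENNReal.rpow_mul]
        norm_num
      rw [mul_pow, key, key]

section cov
variable {E : Type*} [NormedAddCommGroup E] [NormedSpace ℝ E] [MeasurableSpace E] [BorelSpace E]
  [FiniteDimensional ℝ E] (μ : Measure E) [μ.IsAddHaarMeasure]

lemma lint_affine (a : E) (r : ℝ) (hr : r ≠ 0) (h : E → ℝ≥0∞) (hh : Measurable h) :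
    ∫⁻ u, h (a + r • u) ∂μ = ENNReal.ofReal |(r ^ Module.finrank ℝ E)⁻¹| * ∫⁻ x, h x ∂μ := by
  have h1 : ∫⁻ u, h (a + r • u) ∂μ = ∫⁻ u, h (a + u) ∂(μ.map (r • ·)) := by
    rw [lintegral_map (by fun_prop) (by fun_prop)]
  rw [h1, Measure.map_addHaar_smul μ hr, lintegral_smul_measure, lintegral_add_left_eq_self]
  rfl

lemma ae_affine (a : E) (r : ℝ) (hr : r ≠ 0) (p : E → Prop) (hp : ∀ᵐ x ∂μ, p x) :
    ∀ᵐ u ∂μ, p (a + r • u) := by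
  have hs : MeasurableSet (toMeasurable μ {x | ¬ p x}) := measurableSet_toMeasurable _ _
  have h0 : μ (toMeasurable μ {x | ¬ p x}) = 0 := by rw [measure_toMeasurable]; exact hp
  have h1 := lint_affine μ a r hr ((toMeasurable μ {x | ¬ p x}).indicator 1)
    (measurable_one.indicator hs)
  rw [lintegral_indicator_one hs, h0, mul_zero, lintegral_eq_zero_iff
    (show Measurable fun u : E => (toMeasurable μ {x | ¬ p x}).indicator 1 (a + r • u) from
      (measurable_one.indicator hs).comp (by fun_prop))] at h1
  filter_upwards [h1] with u hu
  by_contra hc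
  have : a + r • u ∈ toMeasurable μ {x | ¬ p x} := subset_toMeasurable _ _ hc
  simp [this] at hu
end cov

lemma cpt_bound {E : Type*} [NormedAddCommGroup E] (f : E → ℂ) (hf : Continuous f)
    (hf' : HasCompactSupport f) :
    ∃ R : ℝ, 0 < R ∧ ∃ B : NNReal, (∀ p, ‖f p‖ₑ ≤ B) ∧ ∀ p, f p ≠ 0 → ‖p‖ ≤ R := by
  obtain ⟨C, hC⟩ := hf'.exists_bound_of_continuous hf
  obtain ⟨R, hR0, hR⟩ := hf'.isBounded.exists_pos_norm_le
  refine ⟨R, hR0, C.toNNReal, fun p => ?_, fun p hp => hR p (subset_tsupport _ hp)⟩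
  rw [← ofReal_norm]
  exact ENNReal.ofReal_le_ofReal (hC p)

lemma haar_Ef (n : ℕ) : (volume : Measure (Ef n)).IsAddHaarMeasure :=
  Measure.prod.instIsAddHaarMeasure (volume : Measure (Eb n)) (volume : Measure ℝ)

lemma measSet_half (n : ℕ) : MeasurableSet {p : Ef n | 0 ≤ p.2} :=
  measurableSet_le measurable_const measurable_snd

/-- Extension by zero of the modulus of an element of `L²(ℝⁿ₊)`. -/
def extMod (n : ℕ) (ξ : HS n) : Ef n → ℝ≥0∞ := {p : Ef n | 0 ≤ p.2}.indicator (fun y => ‖ξ y‖ₑ)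

lemma extMod_meas (n : ℕ) (ξ : HS n) : Measurable (extMod n ξ) :=
  ((Lp.stronglyMeasurable ξ).enorm).indicator (measSet_half n)

lemma extMod_sq (n : ℕ) (ξ : HS n) : ∫⁻ y, extMod n ξ y ^ 2 = ∫⁻ y, ‖ξ y‖ₑ ^ 2 ∂(muPlus n) := by
  change _ = ∫⁻ y, _ ∂(volume.restrict {p : Ef n | 0 ≤ p.2})
  rw [← lintegral_indicator (measSet_half n)]
  congr 1; ext y
  by_cases h : 0 ≤ y.2 <;> simp [extMod, Set.indicator, h]

lemma rho_bound (n : ℕ) (f : Ef n × Ef n → ℂ) (ℏ : ℝ) (R : ℝ) (B : NNReal)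
    (hB : ∀ p, ‖f p‖ₑ ≤ B) (hR : ∀ p, f p ≠ 0 → ‖p‖ ≤ R)
    (T : HS n →L[ℂ] HS n) (hT : rhoSpec n ℏ f T) (ξ : HS n) :
    ∫⁻ x, ‖T ξ x‖ₑ ^ 2 ∂(muPlus n) ≤
      (B * volume (Metric.closedBall (0 : Ef n) R)) ^ 2 * ∫⁻ x, ‖ξ x‖ₑ ^ 2 ∂(muPlus n) := by
  have := haar_Ef n
  set Q := Metric.closedBall (0 : Ef n) R with hQ
  have hφ := extMod_meas n ξ
  have h1 : ∀ᵐ x ∂(muPlus n), ‖T ξ x‖ₑ ^ 2 ≤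
      B ^ 2 * (volume Q * ∫⁻ v in Q, extMod n ξ (x - ℏ • v) ^ 2) := by
    filter_upwards [hT ξ] with x hx
    rw [hx]
    have h2 : ‖∫ v in {v : Ef n | ℏ * v.2 ≤ x.2},
        f (x, v) * (ξ (x.1 - ℏ • v.1, x.2 - ℏ * v.2))‖ₑ ≤ B * ∫⁻ v in Q, extMod n ξ (x - ℏ • v) := by
      have hA : MeasurableSet {v : Ef n | ℏ * v.2 ≤ x.2} :=
        measurableSet_le (by fun_prop) measurable_const
      refine (enorm_integral_le_lintegral_enorm _).trans ?_
      rw [← lintegral_const_mul' _ _ ENNReal.coe_ne_top, ← lintegral_indicator hA,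
        ← lintegral_indicator Metric.isClosed_closedBall.measurableSet]
      refine lintegral_mono fun v => ?_
      by_cases hv : v ∈ {v : Ef n | ℏ * v.2 ≤ x.2}
      · rw [Set.indicator_of_mem hv]
        by_cases hf0 : f (x, v) = 0
        · simp [hf0]
        · have hvQ : v ∈ Q := by
            simpa [hQ] using (norm_snd_le (x, v)).trans (hR _ hf0)
          rw [Set.indicator_of_mem hvQ, enorm_mul]
          refine mul_le_mul' (hB _) ?_
          have : x - ℏ • v ∈ {p : Ef n | 0 ≤ p.2} := by
            simpa using hv
          rw [extMod, Set.indicator_of_mem this]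
          exact le_rfl
      · rw [Set.indicator_of_notMem hv]; exact zero_le
    calc _ ≤ _ := pow_le_pow_left' h2 2
      _ ≤ _ := by
        rw [mul_pow]
        gcongr
        have := sq_lintegral_le' (volume.restrict Q) (g := fun v => extMod n ξ (x - ℏ • v))
          (by fun_prop)
        simpa using this
  calc _ ≤ _ := lintegral_mono_ae h1
    _ ≤ ∫⁻ x, B ^ 2 * (volume Q * ∫⁻ v in Q, extMod n ξ (x - ℏ • v) ^ 2) :=
      lintegral_mono' Measure.restrict_le_self le_rfl
    _ = B ^ 2 * (volume Q * ∫⁻ x, ∫⁻ v in Q, extMod n ξ (x - ℏ • v) ^ 2) := by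
      rw [lintegral_const_mul' _ _ (by simp), lintegral_const_mul' _ _
        (isCompact_closedBall _ _).measure_ne_top]
    _ = B ^ 2 * (volume Q * ∫⁻ v in Q, ∫⁻ x, extMod n ξ (x - ℏ • v) ^ 2) := by
      rw [lintegral_lintegral_swap]
      fun_prop
    _ = _ := by
      have : ∀ v, ∫⁻ x, extMod n ξ (x - ℏ • v) ^ 2 = ∫⁻ y, extMod n ξ y ^ 2 := fun v =>
        lintegral_sub_right_eq_self (fun x => extMod n ξ x ^ 2) _
      simp_rw [this, lintegral_const, extMod_sq]
      simp
      ring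

lemma kappa_bound (n : ℕ) (K : Eb n × Eb n × ℝ × ℝ → ℂ) (ℏ : ℝ) (hℏ : 0 < ℏ) (R : ℝ) (B : NNReal)
    (hB : ∀ p, ‖K p‖ₑ ≤ B) (hR : ∀ p, K p ≠ 0 → ‖p‖ ≤ R)
    (S : HS n →L[ℂ] HS n) (hS : kappaSpec n ℏ K S) (ξ : HS n) :
    ∫⁻ x, ‖S ξ x‖ₑ ^ 2 ∂(muPlus n) ≤
      (B ^ 2 * volume (Metric.closedBall (0 : Ef n) R) * volume (Metric.closedBall (0 : Eb n) R)
        * ENNReal.ofReal (2 * R)) * ∫⁻ x, ‖ξ x‖ₑ ^ 2 ∂(muPlus n) := by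
  have := haar_Ef n
  set Q := Metric.closedBall (0 : Ef n) R with hQ
  set Q' := Metric.closedBall (0 : Eb n) R with hQ'
  set J := Metric.closedBall (0 : ℝ) R with hJ
  have hQm : MeasurableSet Q := Metric.isClosed_closedBall.measurableSet
  have hQm' : MeasurableSet Q' := Metric.isClosed_closedBall.measurableSet
  have hJm : MeasurableSet J := Metric.isClosed_closedBall.measurableSet
  have hQQ : (Q : Set (Eb n × ℝ)) = Q' ×ˢ J := by
    rw [hQ, hQ', hJ]; exact (closedBall_prod_same (0 : Eb n) (0 : ℝ) R).symm
  have hφ := extMod_meas n ξ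
  set I := Metric.closedBall (0 : ℝ) (ℏ * R) with hI
  have hIm : MeasurableSet I := Metric.isClosed_closedBall.measurableSet
  set g : Ef n → Ef n → ℝ≥0∞ := fun x y => extMod n ξ (x.1 - ℏ • y.1, ℏ * y.2) with hg
  have h1 : ∀ᵐ x ∂(muPlus n), ‖S ξ x‖ₑ ^ 2 ≤
      B ^ 2 * (volume Q * (I.indicator 1 x.2 * ∫⁻ y in Q, g x y ^ 2)) := by
    filter_upwards [hS ξ] with x hx
    rw [hx]
    have h2 : ‖∫ y' : Eb n, ∫ yn in Ioi (0:ℝ),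
        K (x.1, y', x.2 / ℏ, yn) * (ξ (x.1 - ℏ • y', ℏ * yn))‖ₑ ≤
        B * (I.indicator 1 x.2 * ∫⁻ y in Q, g x y) := by
      have e1 : ‖∫ y' : Eb n, ∫ yn in Ioi (0:ℝ),
        K (x.1, y', x.2 / ℏ, yn) * (ξ (x.1 - ℏ • y', ℏ * yn))‖ₑ ≤
        ∫⁻ y' : Eb n, ∫⁻ yn : ℝ, B * (I.indicator 1 x.2 * Q.indicator (g x) (y', yn)) := by
        refine (enorm_integral_le_lintegral_enorm _).trans (lintegral_mono fun y' => ?_)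
        refine (enorm_integral_le_lintegral_enorm _).trans ?_
        rw [← lintegral_indicator measurableSet_Ioi]
        refine lintegral_mono fun yn => ?_
        by_cases hv : yn ∈ Ioi (0 : ℝ)
        · rw [Set.indicator_of_mem hv]
          by_cases hf0 : K (x.1, y', x.2 / ℏ, yn) = 0
          · simp [hf0]
          · have hN := hR _ hf0
            simp only [Prod.norm_def, max_le_iff] at hN
            have hvQ : ((y', yn) : Ef n) ∈ Q := by
              rw [hQ, mem_closedBall_zero_iff, Prod.norm_def]
              exact max_le hN.2.1 hN.2.2.2
            have hxI : x.2 ∈ I := by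
              rw [hI, mem_closedBall_zero_iff]
              have := hN.2.2.1
              rw [norm_div, Real.norm_of_nonneg hℏ.le, div_le_iff₀ hℏ] at this
              linarith
            rw [Set.indicator_of_mem hvQ, Set.indicator_of_mem hxI, enorm_mul, Pi.one_apply, one_mul]
            refine mul_le_mul' (hB _) ?_
            have : ((x.1 - ℏ • y', ℏ * yn) : Ef n) ∈ {p : Ef n | 0 ≤ p.2} :=
              mul_nonneg hℏ.le (le_of_lt hv)
            rw [hg]
            simp only
            rw [extMod, Set.indicator_of_mem this]
        · rw [Set.indicator_of_notMem hv]; exact zero_le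
      refine e1.trans (le_of_eq ?_)
      have hm : Measurable (Q.indicator (g x)) := by
        refine Measurable.indicator ?_ hQm
        fun_prop
      have hI1 : (I.indicator 1 x.2 : ℝ≥0∞) ≠ ⊤ := by
        by_cases h : x.2 ∈ I <;> simp [h]
      rw [← lintegral_indicator hQm, ← lintegral_const_mul' _ _ hI1,
        ← lintegral_const_mul' _ _ ENNReal.coe_ne_top, Measure.volume_eq_prod,
        lintegral_prod _ (by fun_prop)]
    calc _ ≤ _ := pow_le_pow_left' h2 2
      _ ≤ _ := by
        rw [mul_pow, mul_pow, mul_left_comm (volume Q)]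
        have hsq : (I.indicator 1 x.2 : ℝ≥0∞) ^ 2 = I.indicator 1 x.2 := by
          by_cases h : x.2 ∈ I <;> simp [h]
        rw [hsq]
        gcongr
        have := sq_lintegral_le' (volume.restrict Q) (g := fun v => g x v)
          (by fun_prop)
        simpa using this
  have hΨ : ∫⁻ t : ℝ, ∫⁻ x' : Eb n, extMod n ξ (x', ℏ * t) ^ 2 =
      ENNReal.ofReal ℏ⁻¹ * ∫⁻ y, extMod n ξ y ^ 2 := by
    have := lint_affine (volume : Measure ℝ) 0 ℏ hℏ.ne'
      (fun t => ∫⁻ x' : Eb n, extMod n ξ (x', t) ^ 2)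
      (Measurable.lintegral_prod_left' (f := fun p : Eb n × ℝ => extMod n ξ p ^ 2) (by fun_prop))
    simp only [zero_add, smul_eq_mul, Module.finrank_self, pow_one] at this
    rw [this, abs_of_pos (by positivity)]
    congr 1
    rw [Measure.volume_eq_prod, lintegral_prod_symm _ (by fun_prop)]
  have hmain : ∫⁻ x : Ef n, I.indicator 1 x.2 * ∫⁻ y in Q, g x y ^ 2 ≤
      ENNReal.ofReal (2 * R) * (volume Q' * ∫⁻ y, extMod n ξ y ^ 2) := by
    have hI1 : ∀ t, (I.indicator 1 t : ℝ≥0∞) ≠ ⊤ := fun t => by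
      by_cases h : t ∈ I <;> simp [h]
    have hIm1 : Measurable (I.indicator 1 : ℝ → ℝ≥0∞) := measurable_one.indicator hIm
    simp_rw [← fun x : Ef n => lintegral_const_mul' _ (fun y => g x y ^ 2)
      (μ := volume.restrict Q) (hI1 x.2)]
    rw [lintegral_lintegral_swap (by fun_prop)]
    have inner : ∀ y : Ef n, ∫⁻ x : Ef n, I.indicator 1 x.2 * g x y ^ 2 =
        ENNReal.ofReal (2 * R) * (ENNReal.ofReal ℏ * ∫⁻ x', extMod n ξ (x', ℏ * y.2) ^ 2) := by
      intro y
      rw [Measure.volume_eq_prod, lintegral_prod_symm _ (by fun_prop)]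
      have : ∀ t : ℝ, ∫⁻ x' : Eb n, I.indicator 1 (x', t).2 * g (x', t) y ^ 2 =
          I.indicator 1 t * ∫⁻ x', extMod n ξ (x', ℏ * y.2) ^ 2 := by
        intro t
        rw [lintegral_const_mul' _ _ (hI1 t)]
        congr 1
        exact lintegral_sub_right_eq_self (fun x' : Eb n => extMod n ξ (x', ℏ * y.2) ^ 2) _
      simp_rw [this]
      rw [lintegral_mul_const _ hIm1, lintegral_indicator_one hIm, hI, Real.volume_closedBall,
        ← mul_assoc (ENNReal.ofReal (2 * R)), ← ENNReal.ofReal_mul' hℏ.le]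
      congr 2; ring
    simp_rw [inner]
    rw [lintegral_const_mul' _ _ ENNReal.ofReal_ne_top,
      lintegral_const_mul' _ _ ENNReal.ofReal_ne_top]
    refine mul_le_mul_right ?_ _
    have hPsi : Measurable fun t : ℝ => ∫⁻ x' : Eb n, extMod n ξ (x', ℏ * t) ^ 2 :=
      Measurable.lintegral_prod_left'
        (f := fun p : Eb n × ℝ => extMod n ξ (p.1, ℏ * p.2) ^ 2) (by fun_prop)
    have e2 : ∫⁻ y in Q, ∫⁻ x', extMod n ξ (x', ℏ * y.2) ^ 2 ≤
        volume Q' * (ENNReal.ofReal ℏ⁻¹ * ∫⁻ y, extMod n ξ y ^ 2) := by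
      rw [← hΨ, hQQ, Measure.volume_eq_prod, ← Measure.prod_restrict,
        lintegral_prod (fun y : Eb n × ℝ => ∫⁻ x', extMod n ξ (x', ℏ * y.2) ^ 2)
          (hPsi.comp measurable_snd).aemeasurable]
      simp only [lintegral_const, Measure.restrict_apply MeasurableSet.univ, univ_inter]
      rw [mul_comm]
      gcongr
      exact Measure.restrict_le_self
    calc _ ≤ _ := mul_le_mul_right e2 _
      _ = (ENNReal.ofReal ℏ * ENNReal.ofReal ℏ⁻¹) *
          (volume Q' * ∫⁻ y, extMod n ξ y ^ 2) := by ring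
      _ = _ := by
        rw [← ENNReal.ofReal_mul hℏ.le, mul_inv_cancel₀ hℏ.ne', ENNReal.ofReal_one, one_mul]
  calc _ ≤ _ := lintegral_mono_ae h1
    _ ≤ ∫⁻ x : Ef n, B ^ 2 * (volume Q * (I.indicator 1 x.2 * ∫⁻ y in Q, g x y ^ 2)) :=
      lintegral_mono' Measure.restrict_le_self le_rfl
    _ = B ^ 2 * (volume Q * ∫⁻ x : Ef n, (I.indicator 1 x.2 * ∫⁻ y in Q, g x y ^ 2)) := by
      rw [lintegral_const_mul' _ _ (by simp), lintegral_const_mul' _ _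
        (isCompact_closedBall _ _).measure_ne_top]
    _ ≤ B ^ 2 * (volume Q * (ENNReal.ofReal (2 * R) * (volume Q' * ∫⁻ y, extMod n ξ y ^ 2))) := by
      gcongr
    _ = _ := by
      rw [extMod_sq]; ring

lemma stepA (n : ℕ) (f : Ef n × Ef n → ℂ) (hf : Continuous f)
    (K : Eb n × Eb n × ℝ × ℝ → ℂ) (ℏ : ℝ) (hℏ : 0 < ℏ) (RK : ℝ)
    (hRK : ∀ p, K p ≠ 0 → ‖p‖ ≤ RK)
    (T S : HS n →L[ℂ] HS n) (hT : rhoSpec n ℏ f T) (hS : kappaSpec n ℏ K S)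
    (M : ℝ) (hM : ‖T + S‖ ≤ M) (x0 : Ef n) (R : ℝ) (η : Ef n → ℂ) (hη : Measurable η)
    (hη2 : ∫⁻ u, ‖η u‖ₑ ^ 2 ≠ ⊤) (hηR : ∀ u, η u ≠ 0 → ‖u‖ ≤ R)
    (hs1 : ℏ * R ≤ x0.2) (hs2 : ℏ * (R + RK) < x0.2) :
    ∫⁻ u, {u : Ef n | 0 ≤ (x0 + ℏ • u).2}.indicator
        (fun u => ‖∫ v, f (x0 + ℏ • u, v) * η (u - v)‖ₑ ^ 2) u
      ≤ ENNReal.ofReal M ^ 2 * ∫⁻ u, ‖η u‖ₑ ^ 2 := by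
  have := haar_Ef n
  set c := ENNReal.ofReal |(ℏ ^ Module.finrank ℝ (Ef n))⁻¹| with hc
  have hc0 : c ≠ 0 := by
    rw [hc]; simp only [ne_eq, ENNReal.ofReal_eq_zero, not_le]; positivity
  have hct : c ≠ ⊤ := ENNReal.ofReal_ne_top
  set ξ0 : Ef n → ℂ := fun x => η (ℏ⁻¹ • (x - x0)) with hξ0
  have hξm : Measurable ξ0 := by fun_prop
  have hξη : ∀ u, ξ0 (x0 + ℏ • u) = η u := fun u => by
    simp [hξ0, smul_smul, inv_mul_cancel₀ hℏ.ne']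
  have hξη2 : ∫⁻ u, ‖η u‖ₑ ^ 2 = c * ∫⁻ x, ‖ξ0 x‖ₑ ^ 2 := by
    have := lint_affine (volume : Measure (Ef n)) x0 ℏ hℏ.ne' (fun x => ‖ξ0 x‖ₑ ^ 2) (by fun_prop)
    simpa only [hξη] using this
  have hξ2 : ∫⁻ x, ‖ξ0 x‖ₑ ^ 2 ≠ ⊤ := fun h => by
    rw [hξη2, h, ENNReal.mul_top hc0] at hη2; exact hη2 rfl
  have hle : ∫⁻ x, ‖ξ0 x‖ₑ ^ 2 ∂(muPlus n) ≤ ∫⁻ x, ‖ξ0 x‖ₑ ^ 2 :=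
    lintegral_mono' Measure.restrict_le_self le_rfl
  have hsupp : ∀ x, ξ0 x ≠ 0 → |x.2 - x0.2| ≤ ℏ * R := fun x hx => by
    have h1 := (norm_snd_le _).trans (hηR _ hx)
    simp only [Prod.smul_snd, Prod.snd_sub, smul_eq_mul, norm_mul, norm_inv,
      Real.norm_of_nonneg hℏ.le, Real.norm_eq_abs] at h1
    rwa [inv_mul_le_iff₀ hℏ] at h1
  have hmem : MemLp ξ0 2 (muPlus n) := by
    refine ⟨hξm.aestronglyMeasurable, ?_⟩
    rw [eLpNorm_lt_top_iff_lintegral_rpow_enorm_lt_top (by norm_num) (by norm_num)]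
    simpa using lt_of_le_of_lt hle hξ2.lt_top
  set ξ : HS n := hmem.toLp ξ0 with hξ
  have hae : ∀ᵐ x ∂(muPlus n), ξ x = ξ0 x := hmem.coeFn_toLp
  have hae' : ∀ᵐ x : Ef n, 0 ≤ x.2 → ξ x = ξ0 x :=
    (ae_restrict_iff' (measSet_half n)).1 hae
  -- the truncated operator
  have hTξ : ∀ᵐ x ∂(muPlus n), T ξ x = ∫ v, f (x, v) * ξ0 (x - ℏ • v) := by
    filter_upwards [hT ξ] with x hx
    rw [hx]
    have hA : MeasurableSet {v : Ef n | ℏ * v.2 ≤ x.2} :=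
      measurableSet_le (by fun_prop) measurable_const
    rw [← integral_indicator hA]
    refine integral_congr_ae ?_
    have h2 := ae_affine (volume : Measure (Ef n)) x (-ℏ) (neg_ne_zero.2 hℏ.ne') _ hae'
    filter_upwards [h2] with v hv
    have hv' : ℏ * v.2 ≤ x.2 → ξ (x - ℏ • v) = ξ0 (x - ℏ • v) := fun h => by
      rw [neg_smul, ← sub_eq_add_neg] at hv
      exact hv (by simpa using h)
    by_cases h : v ∈ {v : Ef n | ℏ * v.2 ≤ x.2}
    · rw [Set.indicator_of_mem h, ← hv' h]; rfl
    · rw [Set.indicator_of_notMem h]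
      have : ξ0 (x - ℏ • v) = 0 := by
        by_contra h0
        have := (abs_le.1 (hsupp _ h0)).1
        simp only [Prod.snd_sub, Prod.smul_snd, smul_eq_mul] at this
        simp only [mem_ofPred_eq, not_le] at h
        linarith
      simp [this]
  have hSξ : ∀ᵐ x ∂(muPlus n), S ξ x = 0 := by
    filter_upwards [hS ξ] with x hx
    rw [hx]
    have q1 : ∀ᵐ p : Eb n × ℝ ∂((volume : Measure (Eb n)).prod (volume : Measure ℝ)),
        0 ≤ ℏ * p.2 → ξ (x.1 - ℏ • p.1, ℏ * p.2) = ξ0 (x.1 - ℏ • p.1, ℏ * p.2) := by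
      have h2 := ae_affine (volume : Measure (Ef n)) (x.1, 0) (-ℏ) (neg_ne_zero.2 hℏ.ne') _ hae'
      have h3 : MeasurePreserving (Prod.map id (fun t => -t))
        ((volume : Measure (Eb n)).prod (volume : Measure ℝ))
        ((volume : Measure (Eb n)).prod (volume : Measure ℝ)) :=
        (MeasurePreserving.id _).prod (Measure.measurePreserving_neg _)
      have h4 := h3.quasiMeasurePreserving.ae h2
      filter_upwards [h4] with p hp
      have heq : ((x.1, 0) : Ef n) + (-ℏ) • Prod.map id (fun t => -t) p =
          (x.1 - ℏ • p.1, ℏ * p.2) := by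
        ext <;> simp [sub_eq_add_neg]
      rw [heq] at hp
      exact hp
    have q2 := Measure.ae_ae_of_ae_prod q1
    have : ∀ᵐ y' : Eb n, (∫ yn in Ioi (0:ℝ),
      K (x.1, y', x.2 / ℏ, yn) * (ξ (x.1 - ℏ • y', ℏ * yn))) = 0 := by
      filter_upwards [q2] with y' hy'
      refine integral_eq_zero_of_ae ?_
      refine (ae_restrict_iff' measurableSet_Ioi).2 ?_
      filter_upwards [hy'] with yn hyn hpos
      rw [hyn (mul_nonneg hℏ.le (le_of_lt hpos))]
      by_contra h0
      have hk := left_ne_zero_of_mul h0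
      have hx0 := right_ne_zero_of_mul h0
      have hN := hRK _ hk
      simp only [Prod.norm_def, max_le_iff] at hN
      have h5 := (abs_le.1 hN.2.2.2).2
      have h6 := (abs_le.1 (hsupp _ hx0)).1
      simp only at h6
      nlinarith
    rw [integral_congr_ae this]; simp
  have hmain := sq_le_of_opNorm (T + S) M hM ξ
  have e1 : ∫⁻ x, ‖(T + S) ξ x‖ₑ ^ 2 ∂(muPlus n) =
      ∫⁻ x, {p : Ef n | 0 ≤ p.2}.indicator (fun x => ‖∫ v, f (x, v) * ξ0 (x - ℏ • v)‖ₑ ^ 2) x := by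
    rw [lintegral_indicator (measSet_half n)]
    refine lintegral_congr_ae ?_
    have := Lp.coeFn_add (T ξ) (S ξ)
    filter_upwards [hTξ, hSξ, this] with x h1 h2 h3
    rw [add_apply, h3, Pi.add_apply, h1, h2, add_zero]
  have e2 : ∫⁻ x, ‖ξ x‖ₑ ^ 2 ∂(muPlus n) = ∫⁻ x, ‖ξ0 x‖ₑ ^ 2 ∂(muPlus n) := by
    refine lintegral_congr_ae ?_
    filter_upwards [hae] with x hx
    rw [hx]
  rw [e1, e2] at hmain
  have hmeas : Measurable
      ({p : Ef n | 0 ≤ p.2}.indicator (fun x => ‖∫ v, f (x, v) * ξ0 (x - ℏ • v)‖ₑ ^ 2)) := by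
    refine Measurable.indicator ?_ (measSet_half n)
    have : StronglyMeasurable fun x : Ef n => ∫ v, f (x, v) * ξ0 (x - ℏ • v) := by
      refine StronglyMeasurable.integral_prod_right' (f := fun p : Ef n × Ef n =>
        f p * ξ0 (p.1 - ℏ • p.2)) ?_
      exact (hf.measurable.mul (by fun_prop)).stronglyMeasurable
    exact this.enorm.pow_const 2
  have e3 := lint_affine (volume : Measure (Ef n)) x0 ℏ hℏ.ne' _ hmeas
  calc _ = _ := by
        refine Eq.trans (lintegral_congr fun u => ?_) e3
        simp only [Set.indicator, mem_ofPred_eq]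
        congr 4
        ext v
        congr 1
        rw [← hξη]; congr 1; rw [smul_sub]; abel
    _ ≤ c * (ENNReal.ofReal M ^ 2 * ∫⁻ x, ‖ξ0 x‖ₑ ^ 2) := by
        gcongr
        exact hmain.trans (by gcongr)
    _ = _ := by rw [hξη2]; ring

lemma conv_meas (n : ℕ) (f : Ef n × Ef n → ℂ) (hf : Continuous f) (g : Ef n → ℂ)
    (hg : Measurable g) (x0 : Ef n) (r : ℝ) :
    Measurable fun u : Ef n => ‖∫ v, f (x0 + r • u, v) * g (u - v)‖ₑ ^ 2 := by
  have : StronglyMeasurable fun u : Ef n => ∫ v, f (x0 + r • u, v) * g (u - v) := by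
    refine StronglyMeasurable.integral_prod_right' (f := fun p : Ef n × Ef n =>
      f (x0 + r • p.1, p.2) * g (p.1 - p.2)) ?_
    have hfm : Measurable f := hf.measurable
    exact Measurable.stronglyMeasurable (by fun_prop)
  exact this.enorm.pow_const 2

lemma claimA (n : ℕ) (f : Ef n × Ef n → ℂ) (hf : Continuous f) (hf' : HasCompactSupport f)
    (K : Eb n × Eb n × ℝ × ℝ → ℂ) (hK : Continuous K) (hK' : HasCompactSupport K)
    (T S : ℝ → (HS n →L[ℂ] HS n))
    (hT : ∀ ℏ ∈ Ioc (0:ℝ) 1, rhoSpec n ℏ f (T ℏ))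
    (hS : ∀ ℏ ∈ Ioc (0:ℝ) 1, kappaSpec n ℏ K (S ℏ))
    (M : ℝ) (hM : ∃ᶠ ℏ in 𝓝[>] (0:ℝ), ‖T ℏ + S ℏ‖ ≤ M) (x0 : Ef n) (hx0 : 0 < x0.2)
    (R : ℝ) (η : Ef n → ℂ) (hη : Measurable η)
    (hη2 : ∫⁻ u, ‖η u‖ₑ ^ 2 ≠ ⊤) (hηR : ∀ u, η u ≠ 0 → ‖u‖ ≤ R) :
    ∫⁻ u, ‖∫ v, f (x0, v) * η (u - v)‖ₑ ^ 2 ≤ ENNReal.ofReal M ^ 2 * ∫⁻ u, ‖η u‖ₑ ^ 2 := by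
  have := haar_Ef n
  obtain ⟨RK, -, BK, -, hRK⟩ := cpt_bound K hK hK'
  obtain ⟨Rf, -, B, hB, -⟩ := cpt_bound f hf hf'
  have t0 : Tendsto (fun ℏ : ℝ => ℏ) (𝓝[>] (0:ℝ)) (𝓝 0) := nhdsWithin_le_nhds
  have ev1 : ∀ᶠ ℏ in 𝓝[>] (0:ℝ), ℏ * R < x0.2 := by
    have : Tendsto (fun ℏ : ℝ => ℏ * R) (𝓝[>] (0:ℝ)) (𝓝 (0 * R)) := t0.mul_const R
    rw [zero_mul] at this
    exact this.eventually (gt_mem_nhds hx0)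
  have ev2 : ∀ᶠ ℏ in 𝓝[>] (0:ℝ), ℏ * (R + RK) < x0.2 := by
    have : Tendsto (fun ℏ : ℝ => ℏ * (R + RK)) (𝓝[>] (0:ℝ)) (𝓝 (0 * (R + RK))) := t0.mul_const _
    rw [zero_mul] at this
    exact this.eventually (gt_mem_nhds hx0)
  have ev3 : ∀ᶠ ℏ in 𝓝[>] (0:ℝ), ℏ ∈ Ioc (0:ℝ) 1 := Ioc_mem_nhdsGT one_pos
  obtain ⟨h, hlim, hh⟩ := exists_seq_forall_of_frequently
    (hM.and_eventually (ev1.and (ev2.and ev3)))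
  have hlim0 : Tendsto h atTop (𝓝 0) := t0.comp hlim
  set G : ℕ → Ef n → ℝ≥0∞ := fun k => {u : Ef n | 0 ≤ (x0 + h k • u).2}.indicator
        (fun u => ‖∫ v, f (x0 + h k • u, v) * η (u - v)‖ₑ ^ 2) with hG
  have hGle : ∀ k, ∫⁻ u, G k u ≤ ENNReal.ofReal M ^ 2 * ∫⁻ u, ‖η u‖ₑ ^ 2 := fun k => by
    obtain ⟨h1, h2, h3, h4⟩ := hh k
    exact stepA n f hf K (h k) h4.1 RK hRK (T (h k)) (S (h k)) (hT _ h4) (hS _ h4) M h1 x0 R η hη hη2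
      hηR h2.le h3
  have hGm : ∀ k, Measurable (G k) := fun k =>
    (conv_meas n f hf η hη x0 (h k)).indicator (measurableSet_le (by fun_prop) (by fun_prop))
  have hint : Integrable η := by
    refine ⟨hη.aestronglyMeasurable, ?_⟩
    rw [hasFiniteIntegral_iff_enorm]
    have e1 : ∫⁻ u, ‖η u‖ₑ ≤ ∫⁻ u in Metric.closedBall (0 : Ef n) R, ‖η u‖ₑ := by
      rw [← lintegral_indicator Metric.isClosed_closedBall.measurableSet]
      refine lintegral_mono fun u => ?_
      by_cases hu : η u = 0
      · simp [hu]
      · rw [Set.indicator_of_mem (by simpa using hηR u hu)]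
    have e2 := sq_lintegral_le' (volume.restrict (Metric.closedBall (0 : Ef n) R))
      (g := fun u => ‖η u‖ₑ) (by fun_prop)
    have e3 : (∫⁻ u in Metric.closedBall (0 : Ef n) R, ‖η u‖ₑ) ^ 2 < ⊤ := by
      refine e2.trans_lt (ENNReal.mul_lt_top ?_ ?_)
      · simpa using (isCompact_closedBall (0 : Ef n) R).measure_lt_top
      · exact (setLIntegral_le_lintegral _ _).trans_lt hη2.lt_top
    refine e1.trans_lt ?_
    rw [ENNReal.pow_lt_top_iff] at e3
    simpa using e3
  have hpt : ∀ u, Tendsto (fun k => G k u) atTop (𝓝 (‖∫ v, f (x0, v) * η (u - v)‖ₑ ^ 2)) := by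
    intro u
    have hxl : Tendsto (fun k => x0 + h k • u) atTop (𝓝 x0) := by
      have : Tendsto (fun k => x0 + h k • u) atTop (𝓝 (x0 + (0:ℝ) • u)) :=
        tendsto_const_nhds.add (hlim0.smul_const u)
      simpa using this
    have hI : Tendsto (fun k => ∫ v, f (x0 + h k • u, v) * η (u - v)) atTop
        (𝓝 (∫ v, f (x0, v) * η (u - v))) := by
      refine tendsto_integral_of_dominated_convergence (fun v => B * ‖η (u - v)‖) ?_ ?_ ?_ ?_
      · intro k
        refine Measurable.aestronglyMeasurable ?_
        have hfm : Measurable f := hf.measurable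
        fun_prop
      · exact ((hint.comp_sub_left u).norm).const_mul _
      · intro k
        refine ae_of_all _ fun v => ?_
        rw [norm_mul]
        gcongr
        have := hB (x0 + h k • u, v)
        rw [enorm_eq_nnnorm] at this
        exact_mod_cast this
      · refine ae_of_all _ fun v => ?_
        refine Tendsto.mul_const _ ?_
        have : Continuous fun x : Ef n => f (x, v) := by fun_prop
        exact (this.tendsto x0).comp hxl
    have hI2 : Tendsto (fun k => ‖∫ v, f (x0 + h k • u, v) * η (u - v)‖ₑ ^ 2) atTop
        (𝓝 (‖∫ v, f (x0, v) * η (u - v)‖ₑ ^ 2)) :=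
      ((ENNReal.continuous_pow 2).tendsto _).comp hI.enorm
    refine hI2.congr' ?_
    have hpos : ∀ᶠ k in atTop, 0 < (x0 + h k • u).2 :=
      ((continuous_snd.tendsto x0).comp hxl).eventually (lt_mem_nhds hx0)
    filter_upwards [hpos] with k hk
    rw [hG]
    simp only
    rw [Set.indicator_of_mem (show u ∈ {u : Ef n | 0 ≤ (x0 + h k • u).2} from hk.le)]
  calc _ = ∫⁻ u, liminf (fun k => G k u) atTop := lintegral_congr fun u => (hpt u).liminf_eq.symm
    _ ≤ liminf (fun k => ∫⁻ u, G k u) atTop := lintegral_liminf_le hGm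
    _ ≤ liminf (fun _ : ℕ => ENNReal.ofReal M ^ 2 * ∫⁻ u, ‖η u‖ₑ ^ 2) atTop :=
      liminf_le_liminf (Eventually.of_forall hGle)
    _ = _ := liminf_const _

lemma claimB (n : ℕ) (f : Ef n × Ef n → ℂ) (hf : Continuous f) (hf' : HasCompactSupport f)
    (M : ℝ) (x0 : Ef n)
    (hA : ∀ (R : ℝ) (η : Ef n → ℂ), Measurable η → ∫⁻ u, ‖η u‖ₑ ^ 2 ≠ ⊤ →
      (∀ u, η u ≠ 0 → ‖u‖ ≤ R) →
      ∫⁻ u, ‖∫ v, f (x0, v) * η (u - v)‖ₑ ^ 2 ≤ ENNReal.ofReal M ^ 2 * ∫⁻ u, ‖η u‖ₑ ^ 2)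
    (g : Ef n → ℂ) (hg : Measurable g) (hg2 : ∫⁻ u, ‖g u‖ₑ ^ 2 ≠ ⊤) :
    ∫⁻ u, ‖∫ v, f (x0, v) * g (u - v)‖ₑ ^ 2 ≤ ENNReal.ofReal M ^ 2 * ∫⁻ u, ‖g u‖ₑ ^ 2 := by
  obtain ⟨Rf, -, B, -, hR⟩ := cpt_bound f hf hf'
  set η : ℕ → Ef n → ℂ := fun k => (Metric.closedBall 0 (k : ℝ)).indicator g with hη
  have hηm : ∀ k, Measurable (η k) := fun k =>
    hg.indicator Metric.isClosed_closedBall.measurableSet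
  have hle : ∀ k, ∫⁻ u, ‖η k u‖ₑ ^ 2 ≤ ∫⁻ u, ‖g u‖ₑ ^ 2 := fun k => by
    refine lintegral_mono fun u => ?_
    gcongr
    exact enorm_indicator_le_enorm_self _ _
  have hk : ∀ k, ∫⁻ u, ‖∫ v, f (x0, v) * η k (u - v)‖ₑ ^ 2 ≤
      ENNReal.ofReal M ^ 2 * ∫⁻ u, ‖g u‖ₑ ^ 2 := fun k => by
    refine (hA k (η k) (hηm k) ((hle k).trans_lt hg2.lt_top).ne ?_).trans ?_
    · intro u hu
      have := Set.mem_of_indicator_ne_zero hu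
      simpa using this
    · exact mul_le_mul_right (hle k) _
  have hm : ∀ k, Measurable fun u => ‖∫ v, f (x0, v) * η k (u - v)‖ₑ ^ 2 := fun k => by
    have := conv_meas n f hf (η k) (hηm k) x0 0
    simpa using this
  have hpt : ∀ u, Tendsto (fun k => ‖∫ v, f (x0, v) * η k (u - v)‖ₑ ^ 2) atTop
      (𝓝 (‖∫ v, f (x0, v) * g (u - v)‖ₑ ^ 2)) := by
    intro u
    refine tendsto_const_nhds.congr' ?_
    obtain ⟨N, hN⟩ := exists_nat_ge (‖u‖ + Rf)
    filter_upwards [eventually_ge_atTop N] with k hk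
    have hNk : (N : ℝ) ≤ k := by exact_mod_cast hk
    congr 3
    ext v
    by_cases h0 : f (x0, v) = 0
    · simp [h0]
    · have h1 := (norm_snd_le _).trans (hR _ h0)
      have : u - v ∈ Metric.closedBall (0 : Ef n) (k : ℝ) := by
        rw [mem_closedBall_zero_iff]
        have := norm_sub_le u v
        simp only at h1
        linarith
      rw [hη]
      simp only
      rw [Set.indicator_of_mem this]
  calc _ = ∫⁻ u, liminf (fun k => ‖∫ v, f (x0, v) * η k (u - v)‖ₑ ^ 2) atTop :=
        lintegral_congr fun u => (hpt u).liminf_eq.symm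
    _ ≤ liminf (fun k => ∫⁻ u, ‖∫ v, f (x0, v) * η k (u - v)‖ₑ ^ 2) atTop :=
        lintegral_liminf_le hm
    _ ≤ liminf (fun _ : ℕ => ENNReal.ofReal M ^ 2 * ∫⁻ u, ‖g u‖ₑ ^ 2) atTop :=
      liminf_le_liminf (Eventually.of_forall hk)
    _ = _ := liminf_const _

lemma claimC (n : ℕ) (f : Ef n × Ef n → ℂ) (M : ℝ) (hM : 0 ≤ M)
    (hB : ∀ x0 : Ef n, 0 < x0.2 → ∀ g : Ef n → ℂ, Measurable g → ∫⁻ u, ‖g u‖ₑ ^ 2 ≠ ⊤ →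
      ∫⁻ u, ‖∫ v, f (x0, v) * g (u - v)‖ₑ ^ 2 ≤ ENNReal.ofReal M ^ 2 * ∫⁻ u, ‖g u‖ₑ ^ 2)
    (P : HT n →L[ℂ] HT n) (hP : pi0Spec n f P) : ‖P‖ ≤ M := by
  have : SFinite (muPlus n) := by unfold muPlus; infer_instance
  refine opNorm_le_of_sq P M hM fun ξ => ?_
  have hξm : Measurable (fun p => ‖ξ p‖ₑ ^ 2) := (Lp.stronglyMeasurable ξ).enorm.pow_const 2
  have hfin : ∫⁻ p, ‖ξ p‖ₑ ^ 2 ∂(muT n) ≠ ⊤ := by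
    rw [← Lp_enorm_sq]; simp
  have e : ∫⁻ p, ‖ξ p‖ₑ ^ 2 ∂(muT n) = ∫⁻ x, (∫⁻ u, ‖ξ (x, u)‖ₑ ^ 2) ∂(muPlus n) :=
    lintegral_prod _ hξm.aemeasurable
  have hfin' := hfin
  rw [e] at hfin'
  have hPξ : ∫⁻ p, ‖P ξ p‖ₑ ^ 2 ∂(muT n) =
      ∫⁻ x, (∫⁻ u, ‖∫ w : Ef n, f (x, w) * ξ (x, u - w)‖ₑ ^ 2) ∂(muPlus n) := by
    have hm : Measurable (fun p => ‖P ξ p‖ₑ ^ 2) := (Lp.stronglyMeasurable (P ξ)).enorm.pow_const 2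
    refine (lintegral_prod _ hm.aemeasurable).trans ?_
    refine lintegral_congr_ae ?_
    filter_upwards [Measure.ae_ae_of_ae_prod (hP ξ)] with x hx
    refine lintegral_congr_ae ?_
    filter_upwards [hx] with u hu
    rw [hu]
  have hpos : ∀ᵐ x ∂(muPlus n), 0 < x.2 := by
    refine (ae_restrict_iff' (measSet_half n)).2 ?_
    have h0 : ∀ᵐ t : ℝ, t ≠ 0 := by simp [ae_iff]
    have h1 : ∀ᵐ x : Ef n, x.2 ≠ 0 := Measure.quasiMeasurePreserving_snd.ae h0
    filter_upwards [h1] with x hx hx'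
    exact lt_of_le_of_ne hx' (Ne.symm hx)
  rw [hPξ]
  rw [e, ← lintegral_const_mul _ hξm.lintegral_prod_right']
  refine lintegral_mono_ae ?_
  filter_upwards [hpos, ae_lt_top hξm.lintegral_prod_right' hfin'] with x hx hx2
  exact hB x hx (fun u => ξ (x, u))
    ((Lp.stronglyMeasurable ξ).measurable.comp measurable_prodMk_left) hx2.ne

lemma norm_bdd (n : ℕ) (f : Ef n × Ef n → ℂ) (hf : Continuous f) (hf' : HasCompactSupport f)
    (K : Eb n × Eb n × ℝ × ℝ → ℂ) (hK : Continuous K) (hK' : HasCompactSupport K)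
    (T S : ℝ → (HS n →L[ℂ] HS n))
    (hT : ∀ ℏ ∈ Ioc (0:ℝ) 1, rhoSpec n ℏ f (T ℏ))
    (hS : ∀ ℏ ∈ Ioc (0:ℝ) 1, kappaSpec n ℏ K (S ℏ)) :
    ∃ C : ℝ, ∀ ℏ ∈ Ioc (0:ℝ) 1, ‖T ℏ + S ℏ‖ ≤ C := by
  obtain ⟨RK, -, BK, hBK, hRK⟩ := cpt_bound K hK hK'
  obtain ⟨Rf, -, B, hB, hR⟩ := cpt_bound f hf hf'
  have key : ∀ C : ℝ≥0∞, C ≠ ⊤ → ∀ U : HS n →L[ℂ] HS n,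
      (∀ ξ : HS n, ∫⁻ x, ‖U ξ x‖ₑ ^ 2 ∂(muPlus n) ≤ C * ∫⁻ x, ‖ξ x‖ₑ ^ 2 ∂(muPlus n)) →
      ‖U‖ ≤ C.toReal + 1 := by
    intro C hC U h
    refine opNorm_le_of_sq U _ (by positivity) fun ξ => (h ξ).trans ?_
    gcongr
    rw [← ENNReal.ofReal_pow (by positivity)]
    refine ENNReal.le_ofReal_iff_toReal_le hC (by positivity) |>.2 ?_
    nlinarith [ENNReal.toReal_nonneg (a := C)]
  have := (isCompact_closedBall (0 : Ef n) Rf).measure_ne_top (μ := volume)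
  have := (isCompact_closedBall (0 : Ef n) RK).measure_ne_top (μ := volume)
  have := (isCompact_closedBall (0 : Eb n) RK).measure_ne_top (μ := volume)
  refine ⟨_, fun ℏ hℏ => (norm_add_le _ _).trans (add_le_add
    (key _ ?_ _ (rho_bound n f ℏ Rf B hB hR (T ℏ) (hT ℏ hℏ)))
    (key _ ?_ _ (kappa_bound n K ℏ hℏ.1 RK BK hBK hRK (S ℏ) (hS ℏ hℏ))))⟩
  · finiteness
  · finiteness

/-- For every `f ∈ C_c^∞(ℝⁿ×ℝⁿ)` and every smooth compactly supported `K` on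
`ℝ^{n−1}×ℝ^{n−1}×ℝ₊×ℝ₊`, `liminf_{ℏ→0⁺} ‖ρ_ℏ(f)+κ_ℏ(K)‖ ≥ ‖π₀(f)‖`. -/
theorem statement12 (n : ℕ) (hn : 1 ≤ n) (f : Ef n × Ef n → ℂ)
    (hf : ContDiff ℝ ∞ f) (hf' : HasCompactSupport f)
    (K : Eb n × Eb n × ℝ × ℝ → ℂ)
    (hK : ContDiff ℝ ∞ K) (hK' : HasCompactSupport K)
    (T S : ℝ → (HS n →L[ℂ] HS n))
    (hT : ∀ ℏ ∈ Ioc (0:ℝ) 1, rhoSpec n ℏ f (T ℏ))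
    (hS : ∀ ℏ ∈ Ioc (0:ℝ) 1, kappaSpec n ℏ K (S ℏ))
    (P : HT n →L[ℂ] HT n) (hP : pi0Spec n f P) :
    ‖P‖ ≤ Filter.liminf (fun ℏ => ‖T ℏ + S ℏ‖) (𝓝[>] (0:ℝ)) := by

  have hfc := hf.continuous
  have hKc := hK.continuous
  obtain ⟨C, hC⟩ := norm_bdd n f hfc hf' K hKc hK' T S hT hS
  have ev3 : ∀ᶠ ℏ in 𝓝[>] (0:ℝ), ℏ ∈ Ioc (0:ℝ) 1 := Ioc_mem_nhdsGT one_pos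
  have hcob : IsCoboundedUnder (· ≥ ·) (𝓝[>] (0:ℝ)) (fun ℏ => ‖T ℏ + S ℏ‖) :=
    IsCoboundedUnder.of_frequently_le (a := C) (ev3.mono fun ℏ h => hC ℏ h).frequently
  refine le_of_forall_lt fun c hc => ?_
  obtain ⟨d, hcd, hd⟩ := exists_between hc
  refine hcd.trans_le (le_liminf_of_le hcob ?_)
  by_contra hcon
  have hfr : ∃ᶠ ℏ in 𝓝[>] (0:ℝ), ‖T ℏ + S ℏ‖ ≤ d :=
    (not_eventually.1 hcon).mono fun ℏ h => (not_le.1 h).le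
  obtain ⟨ℏ, h1⟩ := hfr.exists
  refine absurd (claimC n f d ((norm_nonneg _).trans h1) (fun x0 hx0 => ?_) P hP) (not_le.2 hd)
  exact claimB n f hfc hf' d x0 (claimA n f hfc hf' K hKc hK' T S hT hS d hfr x0 hx0)
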